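/- (Corollary 4.3) Let Ω ⊆ ℝ^{m+n} be a domain, m ≥ n ≥ 2, K ≥ 1, and u : Ω → [−∞, +∞) Lebesgue measurable with u(·,y) K-quasi-nearly subharmonic on Ω(y) for each y and u(x,·) K-quasi-nearly subharmonic on Ω(x) for each x. Suppose there is a strictly increasing surjection φ : [0,∞) → [0,∞) such that ∫_{s₀+1}^{∞} s^{(n−1)/(m−1)} φ(s−s₀)^{−1/(m−1)} ds < ∞ for some s₀ ∈ ℕ, and φ(log⁺ u⁺) is locally integrable on Ω. Then u is quasi-nearly subharmonic on Ω. -/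

import Mathlib

open MeasureTheory Metric Set

noncomputable def unitBallVol (E : Type*) [NormedAddCommGroup E] [MeasureSpace E] : ℝ :=
  (volume (ball (0 : E) 1)).toReal

/-- `u` is `K`-quasi-nearly subharmonic n.s. (in the narrow sense) on `D` in dimension `N`:
`u` is measurable, `u⁺` is locally integrable on `D`, and the generalized sub-mean-value
inequality holds for `u` on all closed balls contained in `D`. -/
def IsQNSns {E : Type*} [NormedAddCommGroup E] [MeasureSpace E]
    (N : ℕ) (K : ℝ) (D : Set E) (u : E → ℝ) : Prop :=
  Measurable u ∧ LocallyIntegrableOn (fun x => max (u x) 0) D ∧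
  ∀ x : E, ∀ r : ℝ, 0 < r → closedBall x r ⊆ D →
    u x ≤ (K / (unitBallVol E * r ^ N)) * ∫ y in ball x r, u y

/-- `u` is `K`-quasi-nearly subharmonic on `D`: `u` is measurable, `u⁺` is locally integrable
on `D`, and for every `M ≥ 0` the function `u_M := max {u, -M} + M` satisfies the generalized
sub-mean-value inequality on all closed balls contained in `D`. -/
def IsQNS {E : Type*} [NormedAddCommGroup E] [MeasureSpace E]
    (N : ℕ) (K : ℝ) (D : Set E) (u : E → ℝ) : Prop :=
  Measurable u ∧ LocallyIntegrableOn (fun x => max (u x) 0) D ∧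
  ∀ M : ℝ, 0 ≤ M → ∀ x : E, ∀ r : ℝ, 0 < r → closedBall x r ⊆ D →
    max (u x) (-M) + M ≤ (K / (unitBallVol E * r ^ N)) * ∫ y in ball x r, (max (u y) (-M) + M)


open scoped ENNReal

lemma volume_real_ball_lt_of_subMean {E : Type*} [NormedAddCommGroup E] [NormedSpace ℝ E]
    [FiniteDimensional ℝ E] [MeasureSpace E] [BorelSpace E]
    [(volume : Measure E).IsAddHaarMeasure] {K R l : ℝ} (hK : 1 ≤ K) (hR : 0 < R) (hl : 0 < l)
    {x : E} {v : E → ℝ} (hv : Measurable v) (hvi : IntegrableOn v (ball x R))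
    (hsub : v x * volume.real (ball x R) ≤ K * ∫ y in ball x R, v y)
    (hx : 3 * K * l < v x) (hle : ∀ y ∈ ball x R, v y ≤ (3 * K) ^ 2 * l) :
    volume.real (ball x R) < 9 * K ^ 2 * volume.real (ball x R ∩ {y | l < v y}) := by
  have hV : 0 < volume.real (ball x R) :=
    ENNReal.toReal_pos (measure_ball_pos volume x hR).ne' measure_ball_lt_top.ne
  have hmS : MeasurableSet {y | l < v y} := measurableSet_lt measurable_const hv
  have hi1 : IntegrableOn (fun _ : E => l) (ball x R) :=
    integrableOn_const measure_ball_lt_top.ne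
  have hi2 : IntegrableOn ({y | l < v y}.indicator fun _ : E => (3 * K) ^ 2 * l) (ball x R) :=
    Integrable.indicator (integrableOn_const measure_ball_lt_top.ne) hmS
  have hloc_int : ∫ y in ball x R, v y ≤
      ∫ y in ball x R, (l + {y | l < v y}.indicator (fun _ : E => (3 * K) ^ 2 * l) y) := by
    refine setIntegral_mono_on hvi (hi1.add hi2) measurableSet_ball fun y hy => ?_
    by_cases h : l < v y
    · rw [indicator_of_mem (by exact h)]
      linarith [hle y hy]
    · rw [indicator_of_notMem (by exact h)]
      linarith [not_lt.1 h]
  rw [integral_add hi1 hi2, setIntegral_const, setIntegral_indicator hmS, setIntegral_const,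
    smul_eq_mul, smul_eq_mul] at hloc_int
  set V := volume.real (ball x R)
  set e := volume.real (ball x R ∩ {y | l < v y})
  have h1 : 3 * K * l * V < v x * V := by gcongr
  have h2 : K * ∫ y in ball x R, v y ≤ K * (V * l + e * ((3 * K) ^ 2 * l)) := by gcongr
  have h3 : (K * l) * (3 * V) < (K * l) * (V + 9 * K ^ 2 * e) := by nlinarith
  have h4 := lt_of_mul_lt_mul_left h3 (by positivity)
  linarith

lemma sum_setLIntegral_levels_le {E : Type*} [MeasurableSpace E] {μ : Measure E}
    {v : E → ℝ} (hv : Measurable v) {B : Set E} (hB : MeasurableSet B) (H : E → ℝ≥0∞)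
    {a : ℕ → ℝ} (ha : Monotone a) :
    ∑' k, ∫⁻ x in B ∩ {y | a k < v y ∧ v y ≤ a (k + 1)}, H x ∂μ ≤ ∫⁻ x in B, H x ∂μ := by
  rw [← lintegral_iUnion]
  · exact lintegral_mono_set (iUnion_subset fun _ => inter_subset_left)
  · intro i
    exact hB.inter ((measurableSet_lt measurable_const hv).inter
      (measurableSet_le hv measurable_const))
  · intro i j hij
    refine disjoint_left.2 ?_
    rintro y ⟨-, h1, h2⟩ ⟨-, h3, h4⟩
    rcases lt_or_gt_of_ne hij with h | h
    · exact absurd (ha (Nat.succ_le_of_lt h)) (not_le.2 (h3.trans_le h2))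
    · exact absurd (ha (Nat.succ_le_of_lt h)) (not_le.2 (h1.trans_le h4))

/-- Domar's boundedness criterion for nonnegative functions with a generalized sub-mean-value
property. -/
lemma exists_le_of_subMean_of_lintegral_le {E : Type*} [NormedAddCommGroup E] [NormedSpace ℝ E]
    [FiniteDimensional ℝ E] [MeasureSpace E] [BorelSpace E]
    [(volume : Measure E).IsAddHaarMeasure] {d : ℕ} (hd : Module.finrank ℝ E = d + 1)
    {K ρ : ℝ} (hK : 1 ≤ K) (hρ : 0 < ρ) :
    ∃ c > 0, ∀ (x₀ : E) (v : E → ℝ) (H : E → ℝ≥0∞) (t : ℕ → ℝ) (l : ℝ),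
      Measurable v → (∀ x, 0 ≤ v x) → IntegrableOn v (closedBall x₀ ρ) →
      (∀ x r, 0 < r → closedBall x r ⊆ closedBall x₀ ρ →
        v x * volume.real (ball x r) ≤ K * ∫ y in ball x r, v y) →
      (∀ k, 0 < t k) → Summable t → 0 < l →
      (∀ k, ∀ x ∈ ball x₀ ρ, (3 * K) ^ k * l < v x → 1 ≤ ENNReal.ofReal (t k ^ d) * H x) →
      ENNReal.ofReal ((∑' k, t k) ^ d) * ∫⁻ x in ball x₀ ρ, H x ≤ ENNReal.ofReal c →
      v x₀ ≤ 3 * K * l := by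
  have hν : 0 < volume.real (ball (0 : E) 1) :=
    ENNReal.toReal_pos (measure_ball_pos volume _ one_pos).ne' measure_ball_lt_top.ne
  set ν := volume.real (ball (0 : E) 1)
  have hball : ∀ (x : E) {r : ℝ}, 0 < r → volume.real (ball x r) = r ^ (d + 1) * ν := by
    intro x r hr
    rw [Measure.real, Measure.addHaar_ball_of_pos _ _ hr, hd, ENNReal.toReal_mul,
      ENNReal.toReal_ofReal (by positivity)]
    rfl
  set C := max 1 (9 * K ^ 2 / ν) with hC
  have hC1 : 1 ≤ C := le_max_left _ _
  have hC0 : 0 < C := by linarith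
  have hCν : 9 * K ^ 2 ≤ C ^ (d + 1) * ν := by
    have h1 : 9 * K ^ 2 / ν ≤ C := le_max_right _ _
    have h2 : C ≤ C ^ (d + 1) := le_self_pow₀ hC1 (by simp)
    have := h1.trans h2
    rwa [div_le_iff₀ hν] at this
  refine ⟨ρ / (8 * C) * (ρ / (4 * C)) ^ d, by positivity, ?_⟩
  intro x₀ v H t l hv hv0 hvi hsub ht hts hl hH hA
  by_contra! hcon
  have hT : 0 < ∑' k, t k := hts.tsum_pos (fun k => (ht k).le) 0 (ht 0)
  set T := ∑' k, t k
  have hAfin : ∫⁻ x in ball x₀ ρ, H x ≠ ∞ := by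
    intro h
    rw [h, ENNReal.mul_top (by simp; positivity)] at hA
    simp at hA
  set A := (∫⁻ x in ball x₀ ρ, H x).toReal with hAdef
  have hA' : T ^ d * A ≤ ρ / (8 * C) * (ρ / (4 * C)) ^ d := by
    have := ENNReal.toReal_mono ENNReal.ofReal_ne_top hA
    rwa [ENNReal.toReal_mul, ENNReal.toReal_ofReal (by positivity),
      ENNReal.toReal_ofReal (by positivity)] at this
  have hA0 : 0 ≤ A := ENNReal.toReal_nonneg
  set a : ℕ → ℝ := fun k => (3 * K) ^ k * l with ha
  have ham : Monotone a := by
    intro i j hij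
    simp only [ha]
    gcongr
    linarith
  set F : ℕ → Set E := fun k => ball x₀ ρ ∩ {y | a k < v y ∧ v y ≤ a (k + 1)} with hF
  have hsumF := sum_setLIntegral_levels_le (μ := volume) hv (measurableSet_ball (x := x₀) (ε := ρ))
    H ham
  have hFfin : ∀ k, ∫⁻ x in F k, H x ≠ ∞ := fun k =>
    ((lintegral_mono_set inter_subset_left).trans_lt hAfin.lt_top).ne
  set p : ℕ → ℝ := fun k => (∫⁻ x in F k, H x).toReal with hp
  have hp0 : ∀ k, 0 ≤ p k := fun k => ENNReal.toReal_nonneg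
  have hps : Summable p := ENNReal.summable_toReal (hsumF.trans_lt hAfin.lt_top).ne
  have hpA : ∑' k, p k ≤ A := by
    rw [hp, ← ENNReal.tsum_toReal_eq hFfin]
    exact ENNReal.toReal_mono hAfin hsumF
  set lam := ρ / (4 * C * T) with hlam
  have hlam0 : 0 < lam := by positivity
  set R : ℕ → ℝ := fun k => C * (lam * t k + (lam ^ d)⁻¹ * (p k + p (k + 1))) with hR
  have hR0 : ∀ k, 0 < R k := by
    intro k
    have := ht k
    have := hp0 k
    have := hp0 (k + 1)
    simp only [hR]
    positivity
  have hps' : Summable fun k => p (k + 1) := (summable_nat_add_iff 1).2 hps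
  have hpA' : ∑' k, p (k + 1) ≤ A := by
    have := hps.tsum_eq_zero_add
    linarith [hp0 0]
  have hRs : Summable R := ((hts.mul_left _).add ((hps.add hps').mul_left _)).mul_left _
  have hRsum : ∑' k, R k ≤ ρ / 2 := by
    have h1 : ∑' k, R k = C * (lam * T + (lam ^ d)⁻¹ * (∑' k, p k + ∑' k, p (k + 1))) := by
      simp only [hR]
      rw [tsum_mul_left, ((hts.mul_left _)).tsum_add ((hps.add hps').mul_left _), tsum_mul_left,
        tsum_mul_left, hps.tsum_add hps']
    have h2 : ∑' k, R k ≤ C * (lam * T + (lam ^ d)⁻¹ * (A + A)) := by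
      rw [h1]; gcongr
    have h3 : C * (lam * T) = ρ / 4 := by
      rw [hlam]; field_simp
    have h4 : (lam ^ d)⁻¹ * A ≤ ρ / (8 * C) := by
      rw [inv_mul_le_iff₀ (by positivity)]
      have h5 : ρ / (4 * C) = lam * T := by rw [hlam]; field_simp
      rw [h5, mul_pow] at hA'
      have h6 : T ^ d * A ≤ T ^ d * (lam ^ d * (ρ / (8 * C))) := by linarith
      exact le_of_mul_le_mul_left h6 (by positivity)
    have h5 : C * ((lam ^ d)⁻¹ * (A + A)) ≤ ρ / 4 := by
      calc C * ((lam ^ d)⁻¹ * (A + A)) = 2 * C * ((lam ^ d)⁻¹ * A) := by ring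
        _ ≤ 2 * C * (ρ / (8 * C)) := by gcongr
        _ = ρ / 4 := by field_simp; norm_num
    linarith
  have hRpart : ∀ k, ∑ i ∈ Finset.range k, R i ≤ ρ / 2 := fun k =>
    (hRs.sum_le_tsum _ fun i _ => (hR0 i).le).trans hRsum
  have hchain : ∀ k, ∃ x, dist x x₀ ≤ ∑ i ∈ Finset.range k, R i ∧ 3 * K * a k < v x := by
    intro k
    induction k with
    | zero => exact ⟨x₀, by simp, by simpa [ha] using hcon⟩
    | succ k ih =>
      obtain ⟨x, hxd, hxv⟩ := ih
      have hak : 0 < a k := by simp only [ha]; positivity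
      have hRk := hRpart (k + 1)
      rw [Finset.sum_range_succ] at hRk
      have hsubset : closedBall x (R k) ⊆ closedBall x₀ ρ :=
        closedBall_subset_closedBall' (by linarith)
      have hsubset' : ball x (R k) ⊆ ball x₀ ρ := ball_subset_ball' (by linarith)
      by_contra! hno
      have hle : ∀ y ∈ ball x (R k), v y ≤ (3 * K) ^ 2 * a k := by
        intro y hy
        have h1 := hno y (by
          rw [Finset.sum_range_succ]
          have := dist_triangle y x x₀
          have := mem_ball.1 hy
          linarith)
        have h2 : 3 * K * a (k + 1) = (3 * K) ^ 2 * a k := by simp only [ha]; ring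
        linarith
      have hlt := volume_real_ball_lt_of_subMean hK (hR0 k) hak hv
        (hvi.mono_set (ball_subset_closedBall.trans hsubset)) (hsub x (R k) (hR0 k) hsubset)
        hxv hle
      have hcover : ball x (R k) ∩ {y | a k < v y} ⊆ F k ∪ F (k + 1) := by
        rintro y ⟨hy, hy'⟩
        by_cases h : v y ≤ a (k + 1)
        · exact Or.inl ⟨hsubset' hy, hy', h⟩
        · refine Or.inr ⟨hsubset' hy, not_le.1 h, (hle y hy).trans_eq ?_⟩
          simp only [ha]; ring
      have hmeas : volume.real (ball x (R k) ∩ {y | a k < v y}) ≤ t k ^ d * (p k + p (k + 1)) := by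
        have h1 : volume (ball x (R k) ∩ {y | a k < v y}) ≤
            ENNReal.ofReal (t k ^ d) * ((∫⁻ x in F k, H x) + ∫⁻ x in F (k + 1), H x) := by
          calc volume (ball x (R k) ∩ {y | a k < v y})
              = ∫⁻ _ in ball x (R k) ∩ {y | a k < v y}, 1 := by simp
            _ ≤ ∫⁻ y in ball x (R k) ∩ {y | a k < v y}, ENNReal.ofReal (t k ^ d) * H y :=
                setLIntegral_mono' (measurableSet_ball.inter
                  (measurableSet_lt measurable_const hv))
                  fun y hy => hH k y (hsubset' hy.1) hy.2
            _ = ENNReal.ofReal (t k ^ d) * ∫⁻ y in ball x (R k) ∩ {y | a k < v y}, H y :=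
                lintegral_const_mul' _ _ ENNReal.ofReal_ne_top
            _ ≤ _ := by
                gcongr
                exact (lintegral_mono_set hcover).trans (lintegral_union_le _ _ _)
        have h2 := ENNReal.toReal_mono (ENNReal.mul_ne_top ENNReal.ofReal_ne_top
          (ENNReal.add_ne_top.2 ⟨hFfin k, hFfin (k + 1)⟩)) h1
        rwa [ENNReal.toReal_mul, ENNReal.toReal_ofReal (by have := ht k; positivity),
          ENNReal.toReal_add (hFfin k) (hFfin (k + 1))] at h2
      have hq : 0 ≤ p k + p (k + 1) := add_nonneg (hp0 _) (hp0 _)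
      have hqt := (ht k).le
      have hpow : 9 * K ^ 2 * (t k ^ d * (p k + p (k + 1))) ≤ R k ^ (d + 1) * ν := by
        set q := p k + p (k + 1)
        set α := lam * t k
        set β := (lam ^ d)⁻¹ * q
        have hα : 0 ≤ α := by positivity
        have hβ : 0 ≤ β := by positivity
        have h1 : t k ^ d * q = α ^ d * β := by
          simp only [α, β, mul_pow]; field_simp
        have h2 : α ^ d * β ≤ (α + β) ^ (d + 1) := by
          rw [pow_succ]; gcongr <;> linarith
        calc 9 * K ^ 2 * (t k ^ d * q) ≤ (C ^ (d + 1) * ν) * (α + β) ^ (d + 1) := by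
              rw [h1]; gcongr
          _ = R k ^ (d + 1) * ν := by simp only [hR]; rw [mul_pow]; ring
      rw [hball x (hR0 k)] at hlt
      have : 9 * K ^ 2 * volume.real (ball x (R k) ∩ {y | a k < v y}) ≤
          9 * K ^ 2 * (t k ^ d * (p k + p (k + 1))) := by gcongr
      linarith
  obtain ⟨b, hb⟩ : ∃ b, ∀ x, dist x x₀ ≤ ρ / 2 → v x ≤ b := by
    have hV : 0 < (ρ / 2) ^ (d + 1) * ν := by positivity
    refine ⟨K * (∫ y in closedBall x₀ ρ, v y) / ((ρ / 2) ^ (d + 1) * ν), fun x hx => ?_⟩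
    have hss : closedBall x (ρ / 2) ⊆ closedBall x₀ ρ :=
      closedBall_subset_closedBall' (by linarith)
    rw [le_div_iff₀ hV, ← hball x (half_pos hρ)]
    refine (hsub x (ρ / 2) (half_pos hρ) hss).trans ?_
    exact mul_le_mul_of_nonneg_left (setIntegral_mono_set hvi (Filter.Eventually.of_forall hv0)
      (ball_subset_closedBall.trans hss).eventuallyLE) (by linarith)
  obtain ⟨k, hk⟩ := pow_unbounded_of_one_lt (b / l) (show 1 < 3 * K by linarith)
  obtain ⟨x, hxd, hxv⟩ := hchain k
  have h1 := hb x (hxd.trans (hRpart k))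
  rw [div_lt_iff₀ hl] at hk
  have h2 : a k ≤ 3 * K * a k := le_mul_of_one_le_left (by simp only [ha]; positivity) (by linarith)
  exact absurd (hk.trans_le h2) (not_lt.2 (hxv.le.trans h1))

lemma sum_rpow_sub_one_le {α : ℝ} (hα : 0 < α) (hα1 : α ≤ 1) (n : ℕ) :
    ∑ i ∈ Finset.range n, ((i : ℝ) + 1) ^ (α - 1) ≤ α⁻¹ * (n : ℝ) ^ α := by
  induction n with
  | zero => simp [Real.zero_rpow hα.ne']
  | succ k ih =>
    rw [Finset.sum_range_succ]
    have hx : (0 : ℝ) < k + 1 := by positivity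
    have hB := rpow_one_add_le_one_add_mul_self (s := -((k : ℝ) + 1)⁻¹) (p := α)
      (neg_le_neg (inv_le_one_of_one_le₀ (by linarith [k.cast_nonneg (α := ℝ)]))) hα.le hα1
    have h1 : (k : ℝ) ^ α = ((k : ℝ) + 1) ^ α * (1 + -((k : ℝ) + 1)⁻¹) ^ α := by
      have h0 : (0 : ℝ) ≤ 1 + -((k : ℝ) + 1)⁻¹ := by
        have : ((k : ℝ) + 1)⁻¹ ≤ 1 := inv_le_one_of_one_le₀ (by linarith [k.cast_nonneg (α := ℝ)])
        linarith
      rw [← Real.mul_rpow hx.le h0]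
      congr 1
      field_simp
      ring
    have h2 : ((k : ℝ) + 1) ^ (α - 1) = ((k : ℝ) + 1) ^ α * ((k : ℝ) + 1)⁻¹ := by
      rw [Real.rpow_sub_one hx.ne', div_eq_mul_inv]
    have h3 : (k : ℝ) ^ α ≤ ((k : ℝ) + 1) ^ α * (1 + α * -((k : ℝ) + 1)⁻¹) := by
      rw [h1]; gcongr
    have h4 : α⁻¹ * (k : ℝ) ^ α ≤ α⁻¹ * (((k : ℝ) + 1) ^ α * (1 + α * -((k : ℝ) + 1)⁻¹)) := by
      gcongr
    have h5 : α⁻¹ * (((k : ℝ) + 1) ^ α * (1 + α * -((k : ℝ) + 1)⁻¹)) =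
        α⁻¹ * ((k : ℝ) + 1) ^ α - ((k : ℝ) + 1) ^ α * ((k : ℝ) + 1)⁻¹ := by
      field_simp
      ring
    push_cast
    rw [h2]
    linarith

lemma summable_of_summable_rpow_mul {α : ℝ} (hα : 0 < α) {τ : ℕ → ℝ} (hτ : ∀ k, 0 ≤ τ k)
    (hs : Summable fun k : ℕ => (k : ℝ) ^ α * τ k) : Summable τ := by
  rw [← summable_nat_add_iff 1] at hs ⊢
  refine hs.of_nonneg_of_le (fun k => hτ _) fun k => le_mul_of_one_le_left (hτ _) ?_
  exact Real.one_le_rpow (by push_cast; linarith [k.cast_nonneg (α := ℝ)]) hα.le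

/-- A discrete Hardy-type inequality for the tails of a weighted summable series. -/
lemma summable_tail_rpow {α : ℝ} (hα : 0 < α) (hα1 : α ≤ 1) {τ : ℕ → ℝ} (hτ : ∀ k, 0 ≤ τ k)
    (hs : Summable fun k : ℕ => (k : ℝ) ^ α * τ k) :
    Summable fun S : ℕ => (∑' k, τ (S + k)) ^ α⁻¹ := by
  have hτs := summable_of_summable_rpow_mul hα hτ hs
  set U : ℕ → ℝ := fun S => ∑' k, τ (S + k) with hU
  have hsh : ∀ S, Summable fun k => τ (S + k) := fun S => by
    simpa only [add_comm] using (summable_nat_add_iff S).2 hτs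
  have hU0 : ∀ S, 0 ≤ U S := fun S => tsum_nonneg fun k => hτ _
  have hUs : ∀ S, U S = τ S + U (S + 1) := fun S => by
    simp only [hU]
    rw [(hsh S).tsum_eq_zero_add]
    simp only [add_zero, add_assoc, add_comm 1]
  set A := ∑' k : ℕ, (k : ℝ) ^ α * τ k with hA
  have hw0 : ∀ k : ℕ, 0 ≤ (k : ℝ) ^ α * τ k := fun k => mul_nonneg (by positivity) (hτ k)
  have hA0 : 0 ≤ A := tsum_nonneg hw0
  have htail : ∀ S : ℕ, ∑ k ∈ Finset.range S, (k : ℝ) ^ α * τ k + (S : ℝ) ^ α * U S ≤ A := by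
    intro S
    have h1 := hs.sum_add_tsum_nat_add S
    have h2 : (S : ℝ) ^ α * U S ≤ ∑' k : ℕ, ((k + S : ℕ) : ℝ) ^ α * τ (k + S) := by
      simp only [hU]
      rw [← tsum_mul_left]
      refine ((hsh S).mul_left _).tsum_le_tsum (fun k => ?_) ((summable_nat_add_iff S).2 hs)
      rw [add_comm S k]
      have := hτ (k + S)
      gcongr
      omega
    linarith
  have hG : ∀ n, ∑ i ∈ Finset.range n, ((i : ℝ) + 1) ^ (α - 1) * U (i + 1) =
      ∑ k ∈ Finset.range n, (∑ i ∈ Finset.range k, ((i : ℝ) + 1) ^ (α - 1)) * τ k +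
        (∑ i ∈ Finset.range n, ((i : ℝ) + 1) ^ (α - 1)) * U n := by
    intro n
    induction n with
    | zero => simp
    | succ n ih =>
      rw [Finset.sum_range_succ, ih, Finset.sum_range_succ, Finset.sum_range_succ, hUs n]
      ring
  have hsum : Summable fun i : ℕ => ((i : ℝ) + 1) ^ (α - 1) * U (i + 1) := by
    refine summable_of_sum_range_le (c := α⁻¹ * A)
      (fun i => mul_nonneg (by positivity) (hU0 _)) fun n => ?_
    rw [hG]
    calc _ ≤ ∑ k ∈ Finset.range n, (α⁻¹ * (k : ℝ) ^ α) * τ k + (α⁻¹ * (n : ℝ) ^ α) * U n := by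
          gcongr with k
          · exact hτ k
          · exact sum_rpow_sub_one_le hα hα1 k
          · exact hU0 n
          · exact sum_rpow_sub_one_le hα hα1 n
      _ = α⁻¹ * (∑ k ∈ Finset.range n, (k : ℝ) ^ α * τ k + (n : ℝ) ^ α * U n) := by
          rw [mul_add, Finset.mul_sum]
          simp only [mul_assoc]
      _ ≤ α⁻¹ * A := by have := htail n; gcongr
  rw [← summable_nat_add_iff 1]
  refine (hsum.mul_left (A ^ (α⁻¹ - 1))).of_nonneg_of_le
    (fun i => Real.rpow_nonneg (hU0 _) _) fun i => ?_
  have hp : 0 ≤ α⁻¹ - 1 := by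
    have := (one_le_inv₀ hα).2 hα1
    linarith
  have hx : (0 : ℝ) < (i : ℝ) + 1 := by positivity
  rcases (hU0 (i + 1)).eq_or_lt with h0 | h0
  · change (U (i + 1)) ^ α⁻¹ ≤ _
    rw [← h0, Real.zero_rpow (inv_pos.2 hα).ne']
    simp
  have hle : ((i : ℝ) + 1) ^ α * U (i + 1) ≤ A := by
    have h1 := htail (i + 1)
    have h2 : 0 ≤ ∑ k ∈ Finset.range (i + 1), (k : ℝ) ^ α * τ k :=
      Finset.sum_nonneg fun k _ => hw0 k
    push_cast at h1
    linarith
  have hid : U (i + 1) ^ α⁻¹ =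
      (((i : ℝ) + 1) ^ α * U (i + 1)) ^ (α⁻¹ - 1) * (((i : ℝ) + 1) ^ (α - 1) * U (i + 1)) := by
    rw [Real.mul_rpow (by positivity) h0.le, ← Real.rpow_mul hx.le, Real.rpow_sub_one h0.ne']
    have : α * (α⁻¹ - 1) = -(α - 1) := by field_simp; ring
    rw [this, Real.rpow_neg hx.le]
    have := Real.rpow_pos_of_pos hx (α - 1)
    field_simp
  change U (i + 1) ^ α⁻¹ ≤ _
  rw [hid]
  have := hU0 (i + 1)
  gcongr

lemma summable_of_lintegral_lt_top {φ : ℝ → ℝ} (hφ : StrictMonoOn φ (Ici 0)) (hφ0 : φ 0 = 0)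
    {s₀ : ℕ} {α β : ℝ} (hα : 0 ≤ α) (hβ : 0 ≤ β)
    (h : ∫⁻ s in Ici ((s₀ : ℝ) + 1), ENNReal.ofReal (s ^ α * φ (s - s₀) ^ (-β)) < ∞) :
    Summable fun k : ℕ => (k : ℝ) ^ α * φ ((k : ℝ) + 1) ^ (-β) := by
  have hpos : ∀ s : ℝ, 0 < s → 0 < φ s := fun s hs => by
    rw [← hφ0]; exact hφ (by simp) hs.le hs
  rw [← summable_nat_add_iff 1]
  have hnn : ∀ k : ℕ, 0 ≤ ((k + 1 : ℕ) : ℝ) ^ α * φ (((k + 1 : ℕ) : ℝ) + 1) ^ (-β) := fun k =>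
    mul_nonneg (by positivity) (Real.rpow_nonneg (hpos _ (by positivity)).le _)
  have key : ∑' k : ℕ, ENNReal.ofReal (((k + 1 : ℕ) : ℝ) ^ α * φ (((k + 1 : ℕ) : ℝ) + 1) ^ (-β))
      ≤ ∫⁻ s in Ici ((s₀ : ℝ) + 1), ENNReal.ofReal (s ^ α * φ (s - s₀) ^ (-β)) := by
    set J : ℕ → Set ℝ := fun k => Ico ((s₀ : ℝ) + 1 + k) ((s₀ : ℝ) + 1 + (k + 1 : ℕ)) with hJ
    calc _ ≤ ∑' k, ∫⁻ s in J k, ENNReal.ofReal (s ^ α * φ (s - s₀) ^ (-β)) := by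
          refine ENNReal.tsum_le_tsum fun k => ?_
          calc _ = ∫⁻ _ in J k,
                ENNReal.ofReal (((k + 1 : ℕ) : ℝ) ^ α * φ (((k + 1 : ℕ) : ℝ) + 1) ^ (-β)) := by
                simp [hJ]
            _ ≤ _ := by
                refine setLIntegral_mono' measurableSet_Ico fun s hs => ?_
                obtain ⟨hs1, hs2⟩ := hs
                have hs0 : (0 : ℝ) ≤ s₀ := s₀.cast_nonneg
                have hk0 : (0 : ℝ) ≤ k := k.cast_nonneg
                push_cast at hs2 ⊢
                have h1 : 0 < φ (s - s₀) := hpos _ (by linarith)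
                have h2 : φ (s - s₀) ≤ φ (k + 1 + 1) :=
                  hφ.monotoneOn (by simp; linarith) (by simp; linarith) (by linarith)
                have h3 : φ (k + 1 + 1) ^ (-β) ≤ φ (s - s₀) ^ (-β) :=
                  Real.rpow_le_rpow_of_nonpos h1 h2 (by linarith)
                have h4 : 0 ≤ φ (k + 1 + 1 : ℝ) ^ (-β) := Real.rpow_nonneg (h1.le.trans h2) _
                have h5 : ((k : ℝ) + 1) ^ α ≤ s ^ α :=
                  Real.rpow_le_rpow (by linarith) (by linarith) hα
                have h6 : 0 ≤ s ^ α := Real.rpow_nonneg (by linarith) _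
                gcongr
      _ = ∫⁻ s in ⋃ k, J k, ENNReal.ofReal (s ^ α * φ (s - s₀) ^ (-β)) := by
          rw [lintegral_iUnion (fun _ => measurableSet_Ico)]
          intro i j hij
          refine disjoint_left.2 ?_
          rintro s ⟨h1, h2⟩ ⟨h3, h4⟩
          rcases lt_or_gt_of_ne hij with hlt | hlt
          · have : ((i + 1 : ℕ) : ℝ) ≤ j := by exact_mod_cast hlt
            linarith
          · have : ((j + 1 : ℕ) : ℝ) ≤ i := by exact_mod_cast hlt
            linarith
      _ ≤ _ := by
          refine lintegral_mono_set (iUnion_subset fun k s hs => ?_)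
          have := hs.1
          simp only [mem_Ici]
          linarith [k.cast_nonneg (α := ℝ)]
  have := ENNReal.summable_toReal (key.trans_lt h).ne
  simpa only [ENNReal.toReal_ofReal (hnn _)] using this

lemma volume_real_ball_eq {E : Type*} [NormedAddCommGroup E] [NormedSpace ℝ E]
    [FiniteDimensional ℝ E] [MeasureSpace E] [BorelSpace E]
    [(volume : Measure E).IsAddHaarMeasure] (x : E) {r : ℝ} (hr : 0 < r) :
    volume.real (ball x r) = unitBallVol E * r ^ Module.finrank ℝ E := by
  rw [Measure.real, Measure.addHaar_ball_of_pos _ _ hr, ENNReal.toReal_mul,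
    ENNReal.toReal_ofReal (by positivity), mul_comm, unitBallVol]

lemma IsQNS.integrableOn {E : Type*} [NormedAddCommGroup E] [ProperSpace E] [MeasureSpace E]
    {N : ℕ} {K : ℝ} {D : Set E} {u : E → ℝ} (h : IsQNS N K D u) {x : E} {r : ℝ}
    (hxr : closedBall x r ⊆ D) : IntegrableOn (fun y => max (u y) 0) (closedBall x r) :=
  h.2.1.integrableOn_compact_subset hxr (isCompact_closedBall x r)

section IsQNS

variable {E : Type*} [NormedAddCommGroup E] [NormedSpace ℝ E] [FiniteDimensional ℝ E]
  [MeasureSpace E] [BorelSpace E] [(volume : Measure E).IsAddHaarMeasure] {N : ℕ} {K : ℝ}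
  {D : Set E} {u : E → ℝ}

lemma IsQNS.mul_volume_le (h : IsQNS N K D u) (hN : Module.finrank ℝ E = N) {M : ℝ} (hM : 0 ≤ M)
    {x : E} {r : ℝ} (hr : 0 < r) (hxr : closedBall x r ⊆ D) :
    (max (u x) (-M) + M) * volume.real (ball x r) ≤ K * ∫ y in ball x r, (max (u y) (-M) + M) := by
  have h1 := h.2.2 M hM x r hr hxr
  have hV : 0 < volume.real (ball x r) :=
    ENNReal.toReal_pos (measure_ball_pos volume x hr).ne' measure_ball_lt_top.ne
  rw [← hN, ← volume_real_ball_eq x hr, div_mul_eq_mul_div, le_div_iff₀ hV] at h1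
  exact h1

lemma IsQNS.max_zero_mul_volume_le (h : IsQNS N K D u) (hN : Module.finrank ℝ E = N)
    {x : E} {r : ℝ} (hr : 0 < r) (hxr : closedBall x r ⊆ D) :
    max (u x) 0 * volume.real (ball x r) ≤ K * ∫ y in ball x r, max (u y) 0 := by
  simpa using h.mul_volume_le hN le_rfl hr hxr

end IsQNS

lemma integrableOn_max_neg_add {E : Type*} [MeasurableSpace E] {μ : Measure E} {u : E → ℝ}
    (hu : Measurable u) {s : Set E} (hs : μ s ≠ ∞) (h : IntegrableOn (fun x => max (u x) 0) s μ)
    {M : ℝ} (hM : 0 ≤ M) : IntegrableOn (fun x => max (u x) (-M) + M) s μ := by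
  refine Integrable.mono' (h.add (integrableOn_const (C := M) hs))
    ((hu.max measurable_const).add_const M).aestronglyMeasurable (.of_forall fun x => ?_)
  have h0 : 0 ≤ max (u x) (-M) + M := by linarith [le_max_right (u x) (-M)]
  rw [Real.norm_of_nonneg h0]
  change _ ≤ max (u x) 0 + M
  have : max (u x) (-M) ≤ max (u x) 0 := max_le_max le_rfl (by linarith)
  linarith

section Separately

variable {m n : ℕ} {K : ℝ} {Ω : Set (EuclideanSpace ℝ (Fin m) × EuclideanSpace ℝ (Fin n))}
  {u : EuclideanSpace ℝ (Fin m) × EuclideanSpace ℝ (Fin n) → ℝ}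

/-- A separately quasi-nearly subharmonic function with locally integrable positive part is
quasi-nearly subharmonic. -/
lemma isQNS_of_separately (hK : 1 ≤ K) (humeas : Measurable u)
    (ha : ∀ y, IsQNS m K {x | (x, y) ∈ Ω} (fun x => u (x, y)))
    (hb : ∀ x, IsQNS n K {y | (x, y) ∈ Ω} (fun y => u (x, y)))
    (hloc : LocallyIntegrableOn (fun p => max (u p) 0) Ω) : IsQNS (m + n) (K ^ 2) Ω u := by
  refine ⟨humeas, hloc, ?_⟩
  rintro M hM ⟨x, y⟩ r hr hsub
  set w := fun p => max (u p) (-M) + M with hw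
  have hVm : 0 < volume.real (ball x r) :=
    ENNReal.toReal_pos (measure_ball_pos volume x hr).ne' measure_ball_lt_top.ne
  have hVn : 0 < volume.real (ball y r) :=
    ENNReal.toReal_pos (measure_ball_pos volume y hr).ne' measure_ball_lt_top.ne
  have hvol : unitBallVol (EuclideanSpace ℝ (Fin m) × EuclideanSpace ℝ (Fin n)) * r ^ (m + n) =
      volume.real (ball x r) * volume.real (ball y r) := by
    rw [volume_real_ball_eq x hr, volume_real_ball_eq y hr, finrank_euclideanSpace_fin,
      finrank_euclideanSpace_fin]
    have : unitBallVol (EuclideanSpace ℝ (Fin m) × EuclideanSpace ℝ (Fin n)) =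
        unitBallVol (EuclideanSpace ℝ (Fin m)) * unitBallVol (EuclideanSpace ℝ (Fin n)) := by
      simp only [unitBallVol]
      rw [← ENNReal.toReal_mul, ← Measure.prod_prod, ball_prod_same]
      rfl
    rw [this, pow_add]
    ring
  have hsub' : ∀ x' ∈ closedBall x r, ∀ y' ∈ closedBall y r, (x', y') ∈ Ω := fun x' hx' y' hy' =>
    hsub (by rw [← closedBall_prod_same]; exact ⟨hx', hy'⟩)
  have hyr : closedBall x r ⊆ {x' | (x', y) ∈ Ω} := fun x' hx' =>
    hsub' x' hx' y (mem_closedBall_self hr.le)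
  have hxr : ∀ x' ∈ closedBall x r, closedBall y r ⊆ {y' | (x', y') ∈ Ω} := fun x' hx' y' hy' =>
    hsub' x' hx' y' hy'
  have h1 : w (x, y) * volume.real (ball x r) ≤ K * ∫ x' in ball x r, w (x', y) :=
    (ha y).mul_volume_le (by simp) hM hr hyr
  have hwi : IntegrableOn w (ball x r ×ˢ ball y r) := by
    refine integrableOn_max_neg_add humeas ?_ ?_ hM
    · rw [ball_prod_same]; exact measure_ball_lt_top.ne
    · rw [ball_prod_same]
      exact (hloc.integrableOn_compact_subset hsub (isCompact_closedBall _ _)).mono_set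
        ball_subset_closedBall
  have h2 : ∫ x' in ball x r, w (x', y) * volume.real (ball y r) ≤
      ∫ x' in ball x r, K * ∫ y' in ball y r, w (x', y') := by
    refine setIntegral_mono_on ?_ ?_ measurableSet_ball fun x' hx' => ?_
    · refine Integrable.mul_const (integrableOn_max_neg_add (ha y).1 measure_ball_lt_top.ne ?_ hM) _
      exact ((ha y).integrableOn hyr).mono_set ball_subset_closedBall
    · have hwi' := hwi
      rw [IntegrableOn, Measure.volume_eq_prod, ← Measure.prod_restrict] at hwi'
      exact hwi'.integral_prod_left.const_mul K
    · exact (hb x').mul_volume_le (by simp) hM hr (hxr x' (ball_subset_closedBall hx'))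
  rw [integral_mul_const, integral_const_mul] at h2
  have h3 : ∫ p in ball (x, y) r, w p = ∫ x' in ball x r, ∫ y' in ball y r, w (x', y') := by
    rw [← ball_prod_same, Measure.volume_eq_prod, setIntegral_prod _ hwi]
  change w (x, y) ≤ _ * ∫ p in ball (x, y) r, w p
  rw [h3, hvol, div_mul_eq_mul_div, le_div_iff₀ (by positivity)]
  calc w (x, y) * (volume.real (ball x r) * volume.real (ball y r))
      = w (x, y) * volume.real (ball x r) * volume.real (ball y r) := by ring
    _ ≤ K * (∫ x' in ball x r, w (x', y)) * volume.real (ball y r) := by gcongr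
    _ = K * ((∫ x' in ball x r, w (x', y)) * volume.real (ball y r)) := by ring
    _ ≤ K * (K * ∫ x' in ball x r, ∫ y' in ball y r, w (x', y')) := by gcongr
    _ = _ := by ring

lemma one_le_ofReal_div_mul {T c : ℝ} (hc : 0 < c) {I : ℝ≥0∞}
    (h : ENNReal.ofReal c < ENNReal.ofReal T * I) : 1 ≤ ENNReal.ofReal (T / c) * I := by
  rw [ENNReal.ofReal_div_of_pos hc, ENNReal.div_eq_inv_mul, mul_assoc,
    ← ENNReal.inv_mul_cancel (ENNReal.ofReal_pos.2 hc).ne' ENNReal.ofReal_ne_top]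
  gcongr

/-- The local boundedness criterion behind Armitage and Gardiner's theorem. -/
lemma exists_ball_bound {d e : ℕ} (hm : m = d + 1) (hn : n = e + 1) (he : 0 < e) (hed : e ≤ d)
    (hK : 1 ≤ K) (hΩo : IsOpen Ω) (humeas : Measurable u)
    (ha : ∀ y, IsQNS m K {x | (x, y) ∈ Ω} (fun x => u (x, y)))
    (hb : ∀ x, IsQNS n K {y | (x, y) ∈ Ω} (fun y => u (x, y)))
    {φ : ℝ → ℝ} (hφ : StrictMonoOn φ (Ici 0)) (hφ0 : φ 0 = 0)
    (hs : Summable fun k : ℕ =>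
      (k : ℝ) ^ ((e : ℝ) / d) * φ ((k : ℝ) + 1) ^ (-((1 : ℝ) / d)))
    (hloc_int : LocallyIntegrableOn (fun p => φ (max (Real.log (max (u p) 0)) 0)) Ω)
    {p : EuclideanSpace ℝ (Fin m) × EuclideanSpace ℝ (Fin n)} (hp : p ∈ Ω) :
    ∃ r > 0, ∃ b, ∀ q ∈ ball p r, max (u q) 0 ≤ b := by
  obtain ⟨a, b⟩ := p
  have hd : 0 < d := he.trans_le hed
  have hd' : (0 : ℝ) < d := by exact_mod_cast hd
  have he' : (0 : ℝ) < e := by exact_mod_cast he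
  have hpos : ∀ s : ℝ, 0 < s → 0 < φ s := fun s hs => by
    rw [← hφ0]; exact hφ (by simp) hs.le hs
  obtain ⟨ε, hε, hεΩ⟩ := nhds_basis_closedBall.mem_iff.1 (hΩo.mem_nhds hp)
  obtain ⟨ρ, hρ, rfl⟩ : ∃ ρ, 0 < ρ ∧ ε = 2 * ρ := ⟨ε / 2, half_pos hε, by ring⟩
  have hΩ : ∀ x ∈ closedBall a (2 * ρ), ∀ y ∈ closedBall b (2 * ρ), (x, y) ∈ Ω :=
    fun x hx y hy => hεΩ (by rw [← closedBall_prod_same]; exact ⟨hx, hy⟩)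
  obtain ⟨c₁, hc₁, H₁⟩ := exists_le_of_subMean_of_lintegral_le
    (E := EuclideanSpace ℝ (Fin m)) (d := d) (by simp [hm]) hK hρ
  obtain ⟨c₂, hc₂, H₂⟩ := exists_le_of_subMean_of_lintegral_le
    (E := EuclideanSpace ℝ (Fin n)) (d := e) (by simp [hn]) hK hρ
  set Φ := fun p => ENNReal.ofReal (φ (max (Real.log (max (u p) 0)) 0)) with hΦ
  have hΦm : Measurable Φ := by
    have hmono : Monotone fun s => φ (max s 0) := fun s t hst =>
      hφ.monotoneOn (show (0 : ℝ) ≤ max s 0 from le_max_right _ _)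
        (show (0 : ℝ) ≤ max t 0 from le_max_right _ _) (max_le_max hst le_rfl)
    exact (hmono.measurable.comp
      (Real.measurable_log.comp (humeas.max measurable_const))).ennreal_ofReal
  set I := fun y => ∫⁻ x in ball a (2 * ρ), Φ (x, y) with hI
  have hIfin : ∫⁻ y in ball b (2 * ρ), I y ≠ ∞ := by
    rw [← setLIntegral_prod_symm _ hΦm.aemeasurable, ← Measure.volume_eq_prod, ball_prod_same]
    have := (hloc_int.integrableOn_compact_subset hεΩ (isCompact_closedBall _ _)).mono_set
      ball_subset_closedBall
    exact this.lintegral_lt_top.ne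
  set L := 3 * K with hL
  have hL0 : 0 < L := by positivity
  set τ : ℕ → ℝ := fun k => φ ((k : ℝ) + 1) ^ (-((1 : ℝ) / d)) with hτ
  have hτ0 : ∀ k, 0 < τ k := fun k => Real.rpow_pos_of_pos (hpos _ (by positivity)) _
  have hα : 0 < (e : ℝ) / d := by positivity
  have hα1 : (e : ℝ) / d ≤ 1 := by
    rw [div_le_one hd']; exact_mod_cast hed
  have hτs : Summable τ := summable_of_summable_rpow_mul hα (fun k => (hτ0 k).le) hs
  have hτsh : ∀ S, Summable fun k => τ (S + k) := fun S => by
    simpa only [add_comm] using (summable_nat_add_iff S).2 hτs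
  set U : ℕ → ℝ := fun S => ∑' k, τ (S + k) with hU
  have hU0 : ∀ S, 0 < U S := fun S =>
    (hτsh S).tsum_pos (fun k => (hτ0 _).le) 0 (hτ0 _)
  set t : ℕ → ℝ := fun S => (U S ^ d / c₁) ^ ((1 : ℝ) / e) with ht
  have ht0 : ∀ S, 0 < t S := fun S => by have := hU0 S; simp only [ht]; positivity
  have hte : ∀ S, t S ^ e = U S ^ d / c₁ := fun S => by
    have := hU0 S
    simp only [ht]
    rw [one_div, Real.rpow_inv_natCast_pow (by positivity) he.ne']
  have hts : Summable t := by
    have h1 := (summable_tail_rpow hα hα1 (fun k => (hτ0 k).le) hs).mul_right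
      ((c₁ ^ ((1 : ℝ) / e))⁻¹)
    refine h1.congr fun S => ?_
    have := hU0 S
    change U S ^ ((e : ℝ) / d)⁻¹ * _ = (U S ^ d / c₁) ^ ((1 : ℝ) / e)
    rw [Real.div_rpow (by positivity) hc₁.le, ← Real.rpow_natCast_mul (hU0 S).le, inv_div,
      mul_one_div]
    exact (div_eq_mul_inv _ _).symm
  have hslice : ∀ S : ℕ, ∀ x ∈ ball a ρ, ∀ y ∈ ball b (2 * ρ), L ^ (S + 2) < max (u (x, y)) 0 →
      1 ≤ ENNReal.ofReal (t S ^ e) * I y := by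
    intro S x hx y hy hlt
    rw [hte]
    refine one_le_ofReal_div_mul hc₁ ?_
    by_contra! hcon
    refine absurd hlt (not_lt.2 ?_)
    have hball : ball x ρ ⊆ ball a (2 * ρ) := ball_subset_ball' (by linarith [mem_ball.1 hx])
    have hcball : closedBall x ρ ⊆ {x | (x, y) ∈ Ω} := fun x' hx' =>
      hΩ x' (closedBall_subset_closedBall' (by linarith [mem_ball.1 hx]) hx') y
        (ball_subset_closedBall hy)
    have key := H₁ x (fun x => max (u (x, y)) 0) (fun x => Φ (x, y)) (fun k => τ (S + k))
      (L ^ (S + 1)) ((ha y).1.max measurable_const) (fun _ => le_max_right _ _)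
      ((ha y).integrableOn hcball)
      (fun x' r hr hs => (ha y).max_zero_mul_volume_le (by simp) hr (hs.trans hcball))
      (fun k => hτ0 _) (hτsh S) (by positivity) ?_
      ((mul_le_mul' le_rfl (lintegral_mono_set hball)).trans hcon)
    · rwa [← pow_succ'] at key
    · intro k x' _ hlt'
      rw [← pow_add] at hlt'
      have hexp : Real.exp ((S + k : ℕ) + 1 : ℝ) ≤ L ^ (k + (S + 1)) := by
        have h3 : Real.exp 1 ≤ L := by
          have := Real.exp_one_lt_d9
          linarith
        have h4 : ((S + k : ℕ) + 1 : ℝ) = (k + (S + 1) : ℕ) * 1 := by push_cast; ring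
        rw [h4, Real.exp_nat_mul]
        gcongr
      have hlog : ((S + k : ℕ) + 1 : ℝ) ≤ max (Real.log (max (u (x', y)) 0)) 0 := by
        refine le_max_of_le_left ?_
        rw [Real.le_log_iff_exp_le (lt_of_le_of_lt (by positivity) hlt')]
        exact hexp.trans hlt'.le
      have hφle := hφ.monotoneOn (show (0 : ℝ) ≤ (S + k : ℕ) + 1 by positivity)
        (le_max_right _ _ : (0 : ℝ) ≤ _) hlog
      have hφp : 0 < φ ((S + k : ℕ) + 1) := hpos _ (by positivity)
      have hτd : τ (S + k) ^ d = (φ ((S + k : ℕ) + 1))⁻¹ := by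
        simp only [hτ]
        rw [Real.rpow_neg hφp.le, inv_pow, one_div, Real.rpow_inv_natCast_pow hφp.le hd.ne']
      simp only [hΦ]
      rw [hτd, ← ENNReal.ofReal_mul (by positivity), ENNReal.one_le_ofReal,
        inv_mul_eq_div, one_le_div hφp]
      exact hφle
  have htsh : ∀ S, Summable fun k => t (S + k) := fun S => by
    simpa only [add_comm] using (summable_nat_add_iff S).2 hts
  obtain ⟨S, hS⟩ : ∃ S, (∑' k, t (S + k)) ^ e * (∫⁻ y in ball b (2 * ρ), I y).toReal ≤ c₂ := by
    have h1 : Filter.Tendsto (fun S => ∑' k, t (S + k)) Filter.atTop (nhds 0) := by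
      simpa only [add_comm] using tendsto_sum_nat_add t
    have h2 := (h1.pow e).mul_const (∫⁻ y in ball b (2 * ρ), I y).toReal
    rw [zero_pow he.ne', zero_mul] at h2
    exact (h2.eventually_le_const hc₂).exists
  refine ⟨ρ, hρ, L * L ^ (S + 2), ?_⟩
  rintro ⟨x, y⟩ hq
  rw [← ball_prod_same] at hq
  obtain ⟨hx, hy⟩ := hq
  have hball : ball y ρ ⊆ ball b (2 * ρ) := ball_subset_ball' (by linarith [mem_ball.1 hy])
  have hcball : closedBall y ρ ⊆ {y | (x, y) ∈ Ω} := fun y' hy' =>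
    hΩ x (closedBall_subset_closedBall (by linarith) (ball_subset_closedBall hx)) y'
      (closedBall_subset_closedBall' (by linarith [mem_ball.1 hy]) hy')
  refine H₂ y (fun y => max (u (x, y)) 0) I (fun k => t (S + k)) (L ^ (S + 2))
    ((hb x).1.max measurable_const) (fun _ => le_max_right _ _) ((hb x).integrableOn hcball)
    (fun y' r hr hs => (hb x).max_zero_mul_volume_le (by simp) hr (hs.trans hcball))
    (fun k => ht0 _) (htsh S) (by positivity) ?_ ?_
  · intro k y' hy' hlt
    refine hslice (S + k) x hx y' (hball hy') ?_
    rw [← pow_add] at hlt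
    convert hlt using 2
    ring
  · calc _ ≤ ENNReal.ofReal ((∑' k, t (S + k)) ^ e) * ∫⁻ y in ball b (2 * ρ), I y := by gcongr
      _ = ENNReal.ofReal ((∑' k, t (S + k)) ^ e * (∫⁻ y in ball b (2 * ρ), I y).toReal) := by
          rw [ENNReal.ofReal_mul (pow_nonneg (tsum_nonneg fun k => (ht0 _).le) _),
            ENNReal.ofReal_toReal hIfin]
      _ ≤ _ := ENNReal.ofReal_le_ofReal hS

end Separately

/-- Corollary 4.3: if `u` is separately `K`-quasi-nearly subharmonic on a
domain `Ω ⊆ ℝ^{m+n}` (`m ≥ n ≥ 2`), and there is a strictly increasing surjection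
`φ : [0,∞) → [0,∞)` with `∫_{s₀+1}^{∞} s^{(n−1)/(m−1)} φ(s−s₀)^{−1/(m−1)} ds < ∞` for some
`s₀ ∈ ℕ` and `φ(log⁺ u⁺)` locally integrable on `Ω`, then `u` is quasi-nearly subharmonic
on `Ω`. -/
theorem stmt_14 (m n : ℕ) (hn : 2 ≤ n) (hmn : n ≤ m) {K : ℝ} (hK : 1 ≤ K)
    (Ω : Set (EuclideanSpace ℝ (Fin m) × EuclideanSpace ℝ (Fin n)))
    (hΩo : IsOpen Ω) (hΩc : IsConnected Ω)
    (u : EuclideanSpace ℝ (Fin m) × EuclideanSpace ℝ (Fin n) → ℝ)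
    (humeas : Measurable u)
    (ha : ∀ y : EuclideanSpace ℝ (Fin n),
      IsQNS m K {x | (x, y) ∈ Ω} (fun x => u (x, y)))
    (hb : ∀ x : EuclideanSpace ℝ (Fin m),
      IsQNS n K {y | (x, y) ∈ Ω} (fun y => u (x, y)))
    (φ : ℝ → ℝ) (hφmono : StrictMonoOn φ (Set.Ici 0)) (hφ0 : φ 0 = 0)
    (hφsurj : ∀ t : ℝ, 0 ≤ t → ∃ s : ℝ, 0 ≤ s ∧ φ s = t)
    (s₀ : ℕ)
    (hc1 : ∫⁻ s in Set.Ici ((s₀ : ℝ) + 1),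
        ENNReal.ofReal (s ^ (((n : ℝ) - 1) / ((m : ℝ) - 1)) *
          φ (s - s₀) ^ (-((1 : ℝ) / ((m : ℝ) - 1)))) < ⊤)
    (hc2 : LocallyIntegrableOn (fun p => φ (max (Real.log (max (u p) 0)) 0)) Ω) :
    ∃ K' : ℝ, 1 ≤ K' ∧ IsQNS (m + n) K' Ω u := by
  obtain ⟨d, rfl⟩ : ∃ d, m = d + 1 := ⟨m - 1, by omega⟩
  obtain ⟨e, rfl⟩ : ∃ e, n = e + 1 := ⟨n - 1, by omega⟩
  push_cast at hc1
  simp only [add_sub_cancel_right] at hc1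
  have hs := summable_of_lintegral_lt_top hφmono hφ0 (by positivity) (by positivity) hc1
  refine ⟨K ^ 2, one_le_pow₀ hK, isQNS_of_separately hK humeas ha hb fun p hp => ?_⟩
  obtain ⟨r, hr, b, hbd⟩ := exists_ball_bound rfl rfl (by omega) (by omega) hK hΩo humeas ha hb
    hφmono hφ0 hs hc2 hp
  refine ⟨ball p r, mem_nhdsWithin_of_mem_nhds (ball_mem_nhds p hr), ?_⟩
  refine Measure.integrableOn_of_bounded (M := b) measure_ball_lt_top.ne
    (humeas.max measurable_const).aestronglyMeasurable ?_
  filter_upwards [ae_restrict_mem measurableSet_ball] with q hq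
  rw [Real.norm_of_nonneg (le_max_right _ _)]
  exact hbd q hq
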